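/- arXiv:1611.01570 — 2 statements merged into one kernel-verified Lean document; each statement's English description precedes it below -/
import Mathlib

section
/- For every prime p ≥ 619, N_7(ℤ_p) = 13: the minimum of |A+A| over all 7-element subsets A of the set of squares of ℤ/pℤ equals 13. -/
open Pointwise

/-- `sqSumsetMin R n` is the infimum of `|A + A|` over all `n`-element subsets `A` of the
set of squares `S(R) = {a^2 : a ∈ R}` of the ring `R`. -/
noncomputable def sqSumsetMin (R : Type*) [CommRing R] [DecidableEq R] (n : ℕ) : ℕ :=
  sInf {k | ∃ A : Finset R, (∀ a ∈ A, IsSquare a) ∧ A.card = n ∧ (A + A).card = k}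

namespace SquareProgression

/-- Divide `n` by `q` as long as possible, at most `fuel` times, flipping the sign by `s` each time,
and pass the quotient to `rest`. Here and in `natSign`, recursors are used for the sake of fast
evaluation in the kernel. -/
def stripFactor (q : ℕ) (s : Bool) (rest : ℕ → Option Bool) (fuel : ℕ) : ℕ → Option Bool :=
  Nat.rec rest
    (fun _ strip n => bif (n.mod q).beq 0 then (strip (n.div q)).map (xor s) else rest n) fuel

/-- Parity of the number of entries marked `true` in the factorisation of `n` over the numbers
listed in `σ`; `none` if `n` is not found to be a product of these numbers. -/
def natSign (σ : List (ℕ × Bool)) : ℕ → Option Bool :=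
  List.rec (fun n => bif n.beq 1 then some false else none)
    (fun e _ rest => stripFactor e.1 e.2 rest 12) σ

/-- The extension of `natSign` to the integers, where `ε` is the mark of `-1`. -/
def intSign (ε : Bool) (σ : List (ℕ × Bool)) : ℤ → Option Bool
  | .ofNat n => natSign σ n
  | .negSucc n => (natSign σ (n + 1)).map (xor ε)

/-- The term with index `i` of the progression with first term `x.1 - 3000` and common difference
`x.2`. -/
def term (x : ℕ × ℕ) (i : ℕ) : ℤ :=
  Int.subNatNat (x.1 + i * x.2) 3000

/-- Whether the first seven terms of the progression encoded by `x` have the same sign. -/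
def isMono (ε : Bool) (σ : List (ℕ × Bool)) (x : ℕ × ℕ) : Bool :=
  (intSign ε σ (term x 6)).any fun s =>
    [5, 4, 3, 2, 1, 0].all fun i => (intSign ε σ (term x i)).any fun t => !xor s t

/-- Depth-first search over all markings of the numbers in `qs` extending `σ`. Every branch has to
be closed by a monochromatic progression with difference below `619`, read off from the front of
`cert`. The unused part of `cert` is returned. -/
def search (ε : Bool) : List ℕ → List (ℕ × Bool) → List (ℕ × ℕ) → Option (List (ℕ × ℕ))
  | _, _, [] => none
  | qs, σ, x :: cert =>
    bif Nat.blt 0 x.2 && Nat.blt x.2 619 && isMono ε σ x then some cert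
    else match qs with
    | [] => none
    | q :: qs => (search ε qs ((q, false) :: σ) (x :: cert)).bind (search ε qs ((q, true) :: σ))

/-- Progressions, in the format of `term`, closing all branches when `-1` is a square. -/
def certPos : List (ℕ × ℕ) :=
  [(3001, 1), (2990, 7), (2985, 7), (1537, 247), (2988, 7), (2639, 181), (2898, 71), (2985, 23),
   (2886, 101), (3008, 39), (2808, 217), (2609, 101), (2886, 101), (3008, 39), (3184, 1),
   (2609, 101), (3029, 2), (2994, 11), (2988, 7), (2820, 61), (2952, 53), (2791, 59), (3060, 17),
   (3031, 4), (2791, 59), (2784, 241), (2791, 59), (3031, 2), (2985, 23), (3005, 19), (3010, 277),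
   (3011, 6), (2985, 23), (3005, 19), (3010, 277), (3011, 6), (2810, 73), (2986, 5), (2988, 5),
   (2994, 5), (3003, 13), (2757, 113), (3003, 13), (2979, 19), (2996, 97), (2864, 61), (2586, 127),
   (3033, 2), (2950, 33), (2864, 61), (2630, 139), (2864, 61), (2630, 139), (2864, 61),
   (2808, 217), (2864, 61), (2840, 127), (3029, 2), (2994, 5), (2925, 26), (2940, 49), (2758, 73),
   (3184, 1), (2467, 149), (2334, 193), (3033, 2), (2940, 49), (2758, 73), (3029, 2), (2745, 127),
   (2350, 221), (2943, 23), (3031, 1), (3001, 8), (3003, 8), (2808, 217), (2983, 13), (3064, 1),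
   (2490, 577), (2983, 13), (2739, 101), (3005, 8), (3032, 1), (2967, 109), (2943, 23),
   (2757, 113), (3023, 2), (3001, 8), (2965, 26), (3051, 41), (2950, 47), (2905, 47), (3001, 8),
   (2965, 26), (1869, 553), (2892, 71), (2987, 33), (3001, 8), (3019, 11), (3031, 1), (3001, 8),
   (3019, 11), (2975, 31), (3001, 8), (3019, 11), (3031, 1), (2931, 97), (2975, 31), (2931, 97),
   (3023, 2), (2901, 35), (3022, 7), (2994, 25), (2136, 197), (2900, 73), (2950, 47), (2685, 73),
   (3024, 19), (2879, 28), (2260, 353), (2900, 73), (2685, 73), (3005, 53), (2685, 73), (2881, 27),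
   (2994, 25), (2260, 353), (2900, 73), (2967, 109), (3025, 2), (3022, 7), (3029, 3), (2609, 111),
   (2714, 83), (3022, 7), (3017, 13), (2901, 35), (2792, 83), (2935, 47), (2792, 83), (2919, 31),
   (3032, 3), (3024, 29), (2639, 313), (2919, 31), (3017, 13), (2901, 37), (3032, 3), (2136, 197),
   (3005, 8), (3005, 53), (2978, 107), (3023, 2), (2730, 83), (2685, 73), (2500, 97), (2685, 73),
   (2500, 97), (2685, 73), (2969, 12), (2685, 73), (2969, 12), (3025, 2), (2760, 97), (2730, 83),
   (2901, 37), (3024, 29), (2639, 313), (1869, 553), (2500, 97), (2760, 97), (3024, 29),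
   (2795, 91), (3007, 8), (2971, 12), (2969, 12), (2760, 97), (1537, 247), (2898, 25), (2983, 23),
   (2847, 38), (2973, 217), (2847, 38), (2973, 217), (2936, 29), (3006, 23), (3013, 6), (2776, 89),
   (3013, 6), (3040, 1), (3023, 7), (2925, 139), (3023, 7), (2936, 29), (3006, 23), (2889, 80),
   (2776, 89), (2996, 97), (3023, 7), (2922, 121), (2971, 12), (2969, 12), (3023, 7), (1537, 247),
   (2925, 26), (3027, 7), (2965, 26), (3038, 1), (3027, 7), (3019, 11), (3123, 5), (2680, 67),
   (2685, 73), (3019, 11), (2779, 61), (2757, 113), (2925, 26), (2895, 73), (2500, 97), (2685, 73),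
   (2500, 97), (2810, 73), (2940, 43), (2538, 173), (3011, 3), (2925, 26), (2905, 47), (2940, 49),
   (2685, 73), (2969, 12), (3011, 2), (2992, 3), (3001, 4), (2995, 9), (2977, 12), (3040, 1),
   (2974, 17), (3046, 3), (2790, 157), (2974, 17), (3046, 3), (2974, 31), (2951, 24), (2448, 209),
   (2997, 10), (3040, 3), (3031, 2), (2964, 41), (2995, 9), (2879, 28), (2475, 269), (2776, 89),
   (2872, 83), (2902, 29), (2997, 10), (2923, 20), (2902, 29), (2997, 10), (3031, 2), (2995, 9),
   (2879, 28), (2987, 33), (2889, 41), (2776, 89), (2872, 83), (3027, 2), (2995, 9), (2977, 12),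
   (3040, 1), (3045, 2), (2990, 23), (3046, 3), (2881, 31), (2955, 29), (2448, 209), (2690, 101),
   (3040, 3), (3031, 2), (2964, 41), (2995, 9), (3015, 4), (2995, 9), (3015, 4), (3016, 1),
   (3004, 7), (2966, 13), (2960, 19), (2937, 25), (2966, 13), (2960, 19), (2995, 23), (2797, 41),
   (2776, 89), (3004, 7), (2973, 10), (3004, 7), (2973, 10), (3001, 4), (2896, 27), (2967, 14),
   (2831, 85), (2831, 37), (2974, 17), (2977, 14), (2982, 17), (2951, 24), (2448, 209), (2997, 10),
   (3027, 7), (2923, 41), (2950, 29), (2990, 43), (2925, 29), (2978, 107), (2900, 101), (2896, 27),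
   (3021, 4), (3027, 7), (2907, 53), (2919, 101), (2967, 23), (2592, 163), (2982, 17), (2955, 29),
   (2448, 209), (2944, 25), (3027, 7), (3014, 5), (3003, 4), (2923, 27), (2923, 19), (2904, 61),
   (2923, 41), (2923, 19), (2904, 61), (2923, 19), (2904, 61), (2950, 29), (3023, 7), (3036, 1),
   (2997, 17), (3023, 7), (2923, 27), (2923, 19), (2912, 25), (2923, 41), (3003, 4), (2757, 113),
   (2923, 41), (2923, 19), (2977, 10), (2923, 19), (2977, 10), (2900, 101), (2864, 41), (3003, 4),
   (3013, 1), (2975, 8), (2880, 43), (3013, 3), (3002, 7), (3001, 7), (2744, 157), (3020, 7),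
   (3013, 3), (2940, 41), (3013, 3), (2971, 11), (3001, 7), (2744, 157), (3020, 7), (3013, 3),
   (2940, 41), (2956, 15), (3003, 7), (3002, 7), (3026, 5), (2818, 61), (3003, 7), (2857, 43),
   (2757, 113), (2975, 8), (2989, 10), (3016, 3), (2950, 33), (2989, 9), (2879, 28), (2460, 137),
   (2997, 8), (2975, 8), (2895, 73), (3001, 7), (2985, 46), (3001, 7), (3053, 41), (2969, 15),
   (2963, 32), (3005, 7), (3001, 7), (2985, 46), (2895, 73), (2792, 83), (3001, 7), (2744, 157),
   (2792, 83), (2949, 16), (3004, 7), (2989, 10), (3038, 3), (3059, 1), (2050, 617), (2916, 113),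
   (3054, 13), (2995, 32), (2630, 139), (3094, 41), (2630, 139), (3006, 7), (2997, 8), (2879, 28),
   (2951, 17), (2519, 181), (2879, 28), (2460, 137), (3006, 7), (2997, 8), (3004, 7), (2931, 20),
   (3003, 7), (2970, 29), (3094, 41), (3005, 7), (3006, 7), (2997, 8), (3003, 7), (2985, 8),
   (2934, 17), (2874, 31), (3026, 5), (3048, 17), (3026, 5), (3048, 17), (3003, 7), (2874, 31),
   (2970, 29), (2995, 8), (3005, 6), (3006, 31), (3003, 7), (2985, 8), (2934, 17), (2979, 8),
   (3009, 2), (3002, 7), (3011, 5), (3001, 7), (2658, 257), (3002, 7), (2935, 17), (2730, 83),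
   (3002, 7), (2935, 17), (2538, 173), (2950, 33), (2980, 17), (2935, 17), (2730, 83), (2950, 33),
   (2973, 17), (2935, 17), (2971, 10), (3002, 7), (2935, 17), (2829, 43), (2971, 10), (3026, 3),
   (3020, 7), (2935, 17), (2829, 43), (3002, 7), (3011, 5), (2938, 77), (3003, 7), (2757, 113),
   (2931, 20), (3003, 7), (2830, 53), (3011, 5), (2973, 17), (3003, 7), (3004, 7), (2979, 10),
   (2856, 53), (3004, 7), (2750, 79), (2757, 59), (2965, 13), (2962, 31), (2973, 17), (2757, 59),
   (2952, 17), (3004, 7), (2973, 10), (3004, 7), (2973, 10), (2350, 221), (2985, 16), (2934, 17),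
   (2905, 31), (2937, 23), (2905, 31), (3011, 3), (2995, 2), (3011, 1), (2989, 10), (2790, 67),
   (2989, 10), (2790, 67), (2925, 26), (2730, 83), (2826, 59), (2639, 181), (2730, 83), (2820, 61),
   (3011, 3), (2967, 14), (3001, 8), (3043, 13), (2885, 67), (2826, 59), (3003, 13), (2770, 77),
   (3001, 8), (2142, 229), (3074, 49), (2962, 15), (1784, 247), (2974, 15), (3002, 11), (2956, 15),
   (2940, 49), (2950, 29), (2997, 47), (2925, 59), (3010, 11), (2925, 59), (3010, 11), (2820, 61),
   (2977, 9), (2696, 61), (2977, 9), (3028, 1), (2944, 17), (2935, 17), (2904, 61), (3028, 1),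
   (1537, 247), (2639, 181), (2900, 101), (2944, 17), (2779, 61), (2639, 181), (2977, 9),
   (2826, 59), (2944, 17), (2935, 17), (2998, 13), (2820, 61), (2923, 20), (2959, 22), (3009, 11),
   (3004, 11), (2483, 137), (2275, 349), (3043, 13), (2590, 167), (2959, 21), (2985, 79),
   (2895, 73), (2923, 20), (2959, 22), (3019, 17), (2948, 21), (2938, 77), (2938, 21), (3028, 3),
   (2895, 73), (2790, 67), (3008, 5), (1537, 247), (2966, 25), (3030, 11), (3030, 7), (2966, 25),
   (3030, 11), (3030, 7), (2790, 67), (3008, 5), (3002, 11), (2972, 17), (3023, 7), (2972, 17),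
   (3023, 7), (2972, 17), (2998, 13), (2820, 61), (3001, 3), (1537, 247), (3001, 3), (2951, 13),
   (2977, 12), (2962, 17), (2570, 133), (3032, 11), (2846, 39), (2984, 13), (2838, 37), (3017, 2),
   (3009, 7), (3011, 5), (2871, 125), (3057, 2), (2375, 253), (2913, 37), (2190, 221), (3008, 39),
   (2831, 85), (2984, 13), (3025, 1), (3017, 4), (3070, 17), (2970, 29), (2993, 8), (2868, 107),
   (2829, 47), (3011, 5), (2958, 37), (2919, 37), (2375, 253), (2913, 37), (3005, 9), (3008, 39),
   (2970, 29), (2730, 83), (1537, 247), (2974, 15), (2835, 37), (3001, 3), (2951, 13), (3004, 9),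
   (2984, 13), (3037, 3), (2987, 10), (2848, 41), (2941, 30), (2287, 373), (3044, 3), (3037, 3),
   (2987, 10), (2848, 41), (2810, 67), (2945, 43), (2912, 25), (2945, 17), (2958, 37), (2966, 29),
   (2938, 37), (2945, 17), (2958, 37), (2762, 97), (2846, 103), (3004, 9), (2912, 25), (3040, 3),
   (3032, 11), (3040, 3), (3032, 11), (3002, 3), (3017, 2), (3019, 6), (2948, 19), (3019, 6),
   (2948, 19), (2937, 22), (3002, 9), (2948, 19), (2856, 101), (3063, 1), (2375, 253), (2913, 37),
   (3020, 13), (3029, 3), (3033, 2), (2984, 13), (3025, 1), (3001, 9), (2867, 29), (2337, 313),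
   (3001, 9), (3016, 5), (2856, 101), (3055, 2), (2375, 253), (3029, 8), (3005, 9), (3029, 3),
   (3033, 2), (3001, 9), (2867, 29), (3029, 2), (2951, 13), (3014, 5), (3025, 1), (2896, 29),
   (3070, 17), (2952, 19), (3036, 17), (3015, 19), (2925, 139), (3014, 5), (3002, 3), (2989, 10),
   (2558, 157), (2984, 13), (2989, 10), (2558, 157), (3001, 8), (3003, 8), (2922, 121), (2950, 29),
   (1784, 247), (2989, 10), (2943, 23), (2989, 10), (2943, 23), (2278, 247), (2951, 13), (3009, 7),
   (3001, 8), (2997, 17), (2984, 13), (2956, 15), (3001, 8), (3003, 8), (2524, 151), (2962, 15),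
   (2930, 31), (1784, 247), (2974, 15), (2278, 247), (2952, 13), (2951, 13), (2750, 79),
   (2898, 71), (2972, 13), (2943, 53), (3004, 9), (3034, 3), (2938, 37), (2976, 13), (2972, 13),
   (2967, 13), (2952, 13), (2951, 13), (2558, 157), (2984, 13), (3008, 5), (2967, 13), (2983, 6),
   (2987, 6), (2943, 53), (2810, 73), (3041, 1), (3017, 7), (2190, 221), (3011, 19), (2950, 31),
   (3025, 11), (3017, 7), (2190, 221), (3011, 19), (2950, 31), (3030, 11), (2976, 49), (2900, 31),
   (2826, 41), (2989, 6), (2988, 29), (2931, 20), (2886, 29), (3041, 1), (3024, 7), (2190, 221),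
   (2755, 101), (2900, 31), (2990, 43), (2816, 59), (2886, 29), (2993, 6), (3001, 19), (2989, 10),
   (2904, 61), (2974, 25), (2904, 61), (3005, 19), (2915, 23), (3011, 19), (2994, 25), (3005, 19),
   (3009, 19), (2994, 25), (2993, 6), (3001, 19), (2931, 97), (2974, 25), (2538, 173), (3041, 1),
   (3039, 5), (2190, 221), (3015, 19), (2950, 31), (3009, 19), (2918, 27), (3015, 19), (2950, 31),
   (2974, 25), (2826, 41), (2974, 15), (2976, 29), (3024, 5), (3041, 1), (3034, 5), (2190, 221),
   (2818, 101), (2900, 31), (2990, 43), (2949, 25), (2857, 29), (834, 437), (2936, 29), (2908, 37),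
   (2946, 29), (2908, 37), (2826, 41), (2936, 29), (2864, 41), (2936, 29), (2908, 37), (2857, 29),
   (2908, 37), (2857, 29), (2900, 101), (2993, 8), (3027, 7), (2993, 8), (3027, 7), (2902, 43),
   (2993, 8), (2965, 13), (2908, 87), (3029, 2), (2971, 12), (2318, 149), (2804, 71), (2439, 131),
   (2950, 47), (2902, 43), (2950, 47), (2779, 61), (2964, 31), (2976, 29), (2898, 25), (2976, 29),
   (3011, 2), (2986, 5), (3001, 4), (2994, 5), (2977, 9), (3021, 4), (2948, 19), (2360, 203),
   (2930, 37), (2948, 19), (2360, 203), (2977, 9), (3006, 109), (2930, 37), (2948, 19),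
   (2360, 203), (3003, 4), (2988, 5), (3007, 2), (2975, 8), (2856, 53), (2830, 53), (2898, 127),
   (3020, 7), (3029, 1), (3001, 3), (2988, 29), (3017, 1), (2975, 8), (2989, 10), (3019, 17),
   (3159, 29), (2969, 25), (2824, 61), (3013, 7), (2997, 8), (3029, 1), (2975, 8), (2908, 37),
   (2857, 29), (2949, 16), (2974, 15), (3024, 5), (2991, 8), (3036, 1), (2986, 11), (2997, 8),
   (3017, 1), (2985, 8), (3002, 3), (2985, 8), (3002, 3), (2986, 5), (2994, 5), (3009, 4),
   (3004, 9), (3026, 1), (3009, 4), (3004, 9), (3026, 1), (2994, 5), (2538, 173), (2955, 19),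
   (3004, 9), (3026, 1), (2950, 47), (2967, 37), (2868, 107), (2950, 47), (2915, 49), (3004, 9),
   (3026, 1), (2988, 5)]

/-- Progressions, in the format of `term`, closing all branches when `-1` is not a square. -/
def certNeg : List (ℕ × ℕ) :=
  [(3001, 1), (3004, 7), (3019, 5), (2779, 61), (3004, 7), (3024, 5), (2826, 59), (3006, 31),
   (2830, 53), (3004, 7), (2983, 23), (2826, 59), (2905, 47), (3004, 7), (2983, 23), (2826, 59),
   (2905, 44), (2846, 39), (2868, 107), (3003, 7), (3002, 7), (2993, 8), (3001, 7), (3044, 1),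
   (2727, 64), (3003, 7), (3002, 7), (2550, 127), (3003, 7), (3025, 4), (3001, 7), (2297, 239),
   (2993, 8), (3001, 7), (2993, 9), (2727, 64), (3003, 7), (2993, 8), (3094, 41), (2980, 51),
   (2968, 15), (2993, 8), (3094, 41), (2980, 51), (2968, 15), (2974, 19), (2908, 37), (2974, 19),
   (2908, 37), (2937, 25), (3020, 7), (3001, 7), (2297, 239), (3025, 4), (3001, 7), (2971, 12),
   (2993, 8), (3001, 7), (2971, 12), (2826, 59), (2993, 8), (2883, 41), (2713, 127), (2968, 15),
   (2993, 8), (2883, 41), (2713, 127), (2968, 15), (2974, 19), (3002, 7), (3001, 7), (3044, 1),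
   (2935, 22), (3005, 11), (1124, 431), (2795, 97), (2523, 109), (2839, 55), (2632, 109),
   (3001, 7), (2800, 81), (2974, 19), (3002, 7), (2926, 39), (2955, 22), (2889, 83), (2955, 22),
   (3025, 4), (3019, 6), (2993, 9), (2069, 163), (2961, 16), (2868, 107), (2905, 47), (2779, 61),
   (2974, 19), (2908, 37), (2974, 19), (2908, 37), (2937, 25), (2846, 39), (2968, 73), (2952, 47),
   (2826, 59), (2952, 47), (3012, 13), (3006, 23), (2956, 15), (3006, 7), (3034, 3), (2983, 12),
   (3006, 7), (3045, 1), (3048, 1), (2448, 191), (2983, 12), (3006, 23), (2826, 59), (2760, 71),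
   (2983, 23), (2750, 79), (2983, 23), (2826, 59), (2760, 71), (2983, 23), (2956, 15), (2905, 44),
   (2934, 37), (2793, 107), (2983, 23), (2826, 59), (2760, 71), (2974, 15), (2950, 23), (2972, 17),
   (2962, 15), (2931, 20), (2956, 15), (2940, 41), (2945, 16), (2948, 19), (2871, 44), (2069, 163),
   (2910, 41), (2760, 71), (2826, 59), (2940, 41), (2950, 23), (3002, 5), (3021, 1), (2960, 23),
   (3013, 3), (3022, 5), (2980, 21), (2995, 16), (2879, 36), (2925, 59), (2938, 21), (2925, 59),
   (2889, 80), (2925, 59), (2952, 53), (3021, 1), (2810, 47), (3002, 5), (3019, 2), (2990, 17),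
   (3018, 5), (3092, 41), (2990, 17), (3018, 5), (3092, 41), (2985, 23), (2969, 12), (2985, 23),
   (2969, 12), (2840, 67), (3018, 5), (2971, 19), (3031, 4), (2840, 67), (2952, 53), (3014, 17),
   (3022, 7), (3053, 59), (2718, 67), (2942, 21), (3014, 17), (3022, 7), (2590, 167), (2952, 47),
   (2985, 23), (2969, 12), (2985, 23), (2969, 12), (2952, 47), (2924, 21), (2874, 31), (2924, 21),
   (2874, 31), (2989, 6), (2835, 37), (2983, 6), (2880, 43), (2987, 6), (2974, 15), (2970, 19),
   (2810, 47), (2970, 17), (834, 437), (2985, 8), (3004, 7), (2937, 23), (2977, 9), (2954, 29),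
   (2995, 8), (3017, 13), (2830, 53), (3004, 7), (2810, 47), (2985, 8), (2979, 8), (2924, 21),
   (2955, 19), (2558, 157), (2924, 21), (2945, 16), (2959, 21), (2818, 67), (2989, 8), (2991, 8),
   (3002, 11), (2975, 8), (2950, 23), (2937, 23), (2956, 15), (2978, 107), (2968, 13), (2950, 23),
   (2974, 15), (2835, 37), (2944, 17), (2956, 15), (2932, 23), (2970, 53), (2932, 23), (2937, 29),
   (3026, 73), (2870, 49), (2997, 8), (2968, 13), (2944, 17), (2956, 15), (2558, 157), (3011, 2),
   (3002, 3), (3001, 3), (3004, 9), (2940, 41), (2976, 37), (2888, 47), (3037, 3), (2655, 79),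
   (2888, 47), (2724, 121), (3774, 119), (2655, 79), (2838, 37), (2997, 7), (2985, 16), (3001, 3),
   (2945, 43), (2250, 199), (3025, 4), (3027, 7), (2250, 199), (3026, 5), (2609, 101), (2739, 71),
   (2951, 71), (2913, 31), (2888, 47), (3027, 7), (2913, 31), (2977, 12), (2846, 39), (3014, 11),
   (2808, 217), (2778, 53), (2977, 12), (2846, 39), (2905, 109), (2778, 53), (2977, 12),
   (2913, 31), (2977, 12), (2913, 31), (2974, 15), (2730, 83), (2830, 49), (2937, 23), (2730, 83),
   (2931, 20), (2937, 23), (2964, 31), (2924, 21), (2816, 59), (2913, 31), (2816, 59), (2913, 31),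
   (3011, 2), (2993, 4), (3004, 9), (2997, 8), (2962, 25), (2750, 79), (2880, 43), (3004, 9),
   (2997, 8), (3040, 1), (3045, 2), (2928, 25), (2696, 89), (2680, 67), (3011, 5), (2988, 43),
   (2721, 79), (3040, 1), (3045, 2), (3028, 5), (2879, 28), (2680, 67), (3027, 2), (2745, 127),
   (2997, 7), (2991, 4), (2990, 7), (3013, 1), (2981, 7), (3028, 1), (2931, 20), (2965, 12),
   (2625, 103), (2965, 12), (2625, 103), (2983, 6), (2981, 7), (2987, 6), (2985, 7), (2990, 7),
   (3013, 2), (3009, 4), (3030, 1), (3032, 1), (3006, 17), (2981, 7), (3009, 4), (3030, 1),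
   (2977, 12), (2993, 8), (3014, 17), (2988, 7), (2977, 12), (3006, 17), (2730, 83), (2977, 12),
   (3006, 17), (2977, 12), (3006, 17), (2981, 7), (2977, 12), (2845, 68), (2996, 7), (3014, 5),
   (2985, 7), (3001, 2), (3015, 2), (3025, 2), (2998, 19), (2960, 17), (2950, 27), (2960, 17),
   (2994, 11), (3003, 4), (2872, 43), (2250, 199), (3011, 5), (2590, 167), (3037, 1), (2960, 17),
   (2983, 11), (3001, 4), (2974, 15), (2983, 11), (3015, 2), (3016, 5), (2796, 109), (2915, 49),
   (2826, 59), (2966, 23), (2994, 11), (2835, 37), (2983, 11), (3011, 1), (2968, 11), (2977, 13),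
   (2985, 11), (2964, 11), (2980, 11), (2977, 13), (2974, 11), (2964, 11), (2973, 11), (3013, 6),
   (2977, 11), (2938, 77), (2800, 81), (2977, 11), (2938, 77), (2970, 23), (3013, 6), (2977, 11),
   (3026, 3), (2923, 19), (3028, 1), (2965, 12), (2892, 59), (2246, 179), (3032, 3), (2988, 11),
   (2970, 23), (2965, 12), (2923, 19), (3028, 1), (2964, 11), (2974, 15), (2964, 11), (2980, 11),
   (3008, 5), (2964, 11), (2973, 11), (2992, 3), (2985, 8), (3023, 2), (2978, 107), (2857, 43),
   (2908, 37), (2868, 107), (2956, 17), (2995, 8), (2630, 139), (2883, 41), (2956, 17), (2896, 27),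
   (2928, 43), (3023, 2), (2857, 29), (3033, 1), (2845, 68), (2857, 29), (3017, 1), (2985, 8),
   (2979, 8), (3023, 2), (2886, 29), (2868, 107), (2876, 33), (2989, 8), (2886, 29), (3017, 1),
   (3003, 13), (2995, 9), (3010, 13), (2975, 8), (3012, 13), (2974, 15), (2995, 9), (2931, 20),
   (2995, 9), (2886, 29), (2995, 9), (2886, 29), (2995, 9), (2886, 29), (3003, 13), (2949, 16),
   (3008, 5), (3012, 13), (2949, 43), (3019, 6), (2734, 79), (2913, 31), (2931, 20), (2857, 43),
   (3008, 5), (2968, 73), (3030, 13), (2490, 257), (2913, 31), (2931, 20), (2949, 43), (2876, 33),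
   (2997, 8), (2857, 29), (3011, 2), (2932, 19), (2558, 157), (2895, 73), (2946, 19), (2960, 19),
   (2973, 19), (2932, 19), (2925, 139), (2937, 25), (2967, 19), (2923, 20), (2946, 19), (2960, 19),
   (2973, 19), (3001, 6), (2886, 101), (2946, 19), (3009, 7), (2796, 109), (2946, 19), (2924, 21),
   (3001, 6), (2998, 9), (3064, 61), (2946, 19), (2796, 109), (2946, 19), (2796, 109), (2946, 19),
   (2924, 21), (3009, 7), (2937, 25), (3009, 7), (2930, 37), (2946, 19), (2770, 77), (3009, 7),
   (2930, 37), (2946, 19), (2925, 139), (2937, 25), (2998, 9), (3085, 97), (2879, 28), (2946, 19),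
   (2998, 9), (3006, 169), (2946, 19), (2839, 33), (2952, 53), (2946, 19), (2998, 9), (3025, 11),
   (2879, 28), (2946, 19), (2998, 9), (3006, 169), (2946, 19), (2937, 19), (2951, 19), (3019, 5),
   (2478, 551), (2951, 19), (3024, 5), (2478, 551), (2985, 16), (2974, 15), (2760, 97), (2912, 25),
   (2760, 97), (3008, 29), (2770, 77), (2760, 97), (3008, 29), (2977, 12), (2912, 25), (2977, 12),
   (3008, 29), (2757, 113), (2915, 49), (2961, 19), (2936, 19), (2915, 49), (2942, 19), (2936, 19),
   (2915, 49), (2961, 19), (2936, 19), (2956, 15), (2936, 19), (2940, 41), (2936, 19), (2931, 97),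
   (2942, 19), (2936, 19), (2940, 41), (2936, 19), (2956, 15), (2936, 19), (3016, 3), (2936, 19),
   (3016, 3), (2936, 19), (3016, 3), (2936, 19), (3016, 3), (2936, 19), (2940, 41), (2936, 19),
   (3033, 1), (2942, 19), (2936, 19), (3011, 2), (2993, 4), (3002, 5), (2932, 19), (3003, 5),
   (2932, 19), (3003, 5), (3002, 5), (2991, 4), (2992, 3), (3009, 2), (2880, 43), (2945, 16),
   (3020, 7), (2962, 25), (2945, 16), (2852, 131), (2931, 29), (2943, 20), (2829, 47), (2829, 43),
   (3002, 5), (2956, 19), (3002, 5), (3013, 2), (3009, 4), (2995, 9), (3026, 1), (2955, 17),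
   (3009, 4), (2995, 9), (3026, 1), (2974, 15), (2955, 17), (2995, 9), (2977, 12), (2898, 71),
   (2995, 9), (3026, 1), (2790, 67), (2960, 17), (2971, 11), (2993, 8), (2840, 67), (2790, 67),
   (2971, 11), (2847, 38), (2971, 11), (2847, 38), (2955, 17), (3035, 1), (3008, 11), (2847, 38),
   (2931, 20), (2928, 43), (2971, 11), (2847, 38), (3004, 5), (2960, 17), (2971, 11), (2979, 29),
   (3004, 5), (2971, 11), (3016, 5), (2938, 21), (2715, 82), (2971, 11), (2979, 29), (2955, 17),
   (3033, 1), (3016, 5), (2886, 101), (3033, 1), (2973, 14), (2896, 49), (2945, 17), (2840, 67),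
   (2928, 43), (3033, 1), (2069, 163), (2945, 17), (2069, 163), (2945, 17), (2840, 67)]

/-- The numbers whose quadratic character is branched on. -/
def branchPrimes : List ℕ :=
  [2, 3, 5, 7, 11, 13, 17, 19, 23, 29, 31, 37, 41, 43, 47, 53, 59, 61, 67, 71]

theorem search_certPos : (search false branchPrimes [] certPos).isSome := by
  decide +kernel

theorem search_certNeg : (search true branchPrimes [] certNeg).isSome := by
  decide +kernel

section Soundness

variable {F : Type*} [Field F] {g : F}

/-- `x` has sign `s` relative to `g`: `x` is a square if `s = false`, and `g * x` is a square if
`s = true`. Zero has both signs. -/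
def HasSign (g : F) (s : Bool) (x : F) : Prop :=
  IsSquare ((if s then g else 1) * x)

theorem hasSign_one : HasSign g false 1 := by
  simp [HasSign]

theorem HasSign.mul (hg : g ≠ 0) {s t : Bool} {x y : F} (hx : HasSign g s x)
    (hy : HasSign g t y) : HasSign g (xor s t) (x * y) := by
  obtain ⟨u, hu⟩ := hx
  obtain ⟨v, hv⟩ := hy
  have huv : ((if s then g else 1) * x) * ((if t then g else 1) * y) = (u * v) * (u * v) := by
    rw [hu, hv]; ring
  cases s <;> cases t <;> simp only [Bool.false_eq_true, if_true, if_false] at huv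
  · exact ⟨u * v, by simp [← huv]⟩
  · exact ⟨u * v, by simp [← huv]; ring⟩
  · exact ⟨u * v, by simp [← huv]; ring⟩
  · refine ⟨u * v / g, ?_⟩
    simp only [bne_self_eq_false, Bool.false_eq_true, if_false]
    field_simp
    linear_combination huv

theorem hasSign_stripFactor (hg : g ≠ 0) {q : ℕ} {s : Bool} (hq : HasSign g s (q : F))
    {rest : ℕ → Option Bool} (hrest : ∀ n t, rest n = some t → HasSign g t (n : F))
    (fuel n : ℕ) (t : Bool) (h : stripFactor q s rest fuel n = some t) :
    HasSign g t (n : F) := by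
  induction fuel generalizing n t with
  | zero => exact hrest n t h
  | succ fuel ih =>
    change (bif (n.mod q).beq 0 then (stripFactor q s rest fuel (n.div q)).map (xor s)
      else rest n) = some t at h
    cases hn : (n.mod q).beq 0 with
    | false => exact hrest n t (by simpa only [hn, cond_false] using h)
    | true =>
      simp only [hn, cond_true, Option.map_eq_some_iff] at h
      obtain ⟨r, hr, rfl⟩ := h
      have hmul : q * n.div q = n :=
        Nat.mul_div_cancel' (Nat.dvd_of_mod_eq_zero (Nat.eq_of_beq_eq_true hn))
      have hsign := hq.mul hg (ih _ _ hr)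
      rwa [← Nat.cast_mul, hmul] at hsign

theorem hasSign_natSign (hg : g ≠ 0) {σ : List (ℕ × Bool)}
    (hσ : ∀ e ∈ σ, HasSign g e.2 (e.1 : F)) (n : ℕ) (s : Bool) (h : natSign σ n = some s) :
    HasSign g s (n : F) := by
  induction σ generalizing n s with
  | nil =>
    change (bif n.beq 1 then some false else none) = some s at h
    cases hn : n.beq 1 with
    | false => simp [hn] at h
    | true =>
      obtain rfl := Nat.eq_of_beq_eq_true hn
      simp only [hn, cond_true, Option.some.injEq] at h
      subst h
      simpa using hasSign_one
  | cons e σ ih =>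
    exact hasSign_stripFactor hg (hσ e List.mem_cons_self)
      (ih fun e he => hσ e (List.mem_cons_of_mem _ he)) 12 n s h

theorem hasSign_intSign (hg : g ≠ 0) {ε : Bool} (hε : HasSign g ε (-1 : F))
    {σ : List (ℕ × Bool)} {n : ℤ} {s : Bool}
    (hσ : ∀ e ∈ σ, HasSign g e.2 (e.1 : F)) (h : intSign ε σ n = some s) :
    HasSign g s (n : F) := by
  cases n with
  | ofNat n => simpa using hasSign_natSign hg hσ n s h
  | negSucc n =>
    simp only [intSign, Option.map_eq_some_iff] at h
    obtain ⟨r, hr, rfl⟩ := h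
    have := hε.mul hg (hasSign_natSign hg hσ _ r hr)
    rwa [neg_one_mul, ← Int.cast_natCast, ← Int.cast_neg] at this

theorem exists_hasSign_of_isMono (hg : g ≠ 0) {ε : Bool} (hε : HasSign g ε (-1 : F))
    {σ : List (ℕ × Bool)} {x : ℕ × ℕ}
    (hσ : ∀ e ∈ σ, HasSign g e.2 (e.1 : F)) (h : isMono ε σ x) :
    ∃ s, ∀ i : ℕ, i < 7 → HasSign g s ((x.1 - 3000 : F) + i * x.2) := by
  have hterm (i : ℕ) : ((term x i : ℤ) : F) = (x.1 - 3000 : F) + i * x.2 := by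
    rw [term, Int.subNatNat_eq_coe]
    push_cast
    ring
  obtain ⟨s, hs, hall⟩ := (Option.any_eq_true _ _).1 h
  refine ⟨s, fun i hi => ?_⟩
  rw [← hterm]
  rcases Nat.lt_succ_iff_lt_or_eq.1 hi with hi | rfl
  · obtain ⟨t, ht, hst⟩ := (Option.any_eq_true _ _).1
      (List.all_eq_true.1 hall i (by simp only [List.mem_cons]; omega))
    obtain rfl : s = t := by simpa using hst
    exact hasSign_intSign hg hε hσ ht
  · exact hasSign_intSign hg hε hσ hs

theorem exists_progression_of_search (hg : g ≠ 0)
    (htot : ∀ x : F, HasSign g false x ∨ HasSign g true x) {ε : Bool}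
    (hε : HasSign g ε (-1 : F)) {qs : List ℕ} {σ : List (ℕ × Bool)} {cert : List (ℕ × ℕ)}
    (hσ : ∀ e ∈ σ, HasSign g e.2 (e.1 : F)) (h : (search ε qs σ cert).isSome) :
    ∃ (a : F) (d : ℕ) (s : Bool), 0 < d ∧ d < 619 ∧
      ∀ i : ℕ, i < 7 → HasSign g s (a + i * d) := by
  have close {σ : List (ℕ × Bool)} {x : ℕ × ℕ} (hσ : ∀ e ∈ σ, HasSign g e.2 (e.1 : F))
      (hx : (Nat.blt 0 x.2 && Nat.blt x.2 619 && isMono ε σ x) = true) :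
      ∃ (a : F) (d : ℕ) (s : Bool), 0 < d ∧ d < 619 ∧
        ∀ i : ℕ, i < 7 → HasSign g s (a + i * d) := by
    simp only [Bool.and_eq_true, Nat.blt_eq] at hx
    obtain ⟨s, hs⟩ := exists_hasSign_of_isMono hg hε hσ hx.2
    exact ⟨_, x.2, s, hx.1.1, hx.1.2, hs⟩
  induction qs generalizing σ cert with
  | nil =>
    cases cert with
    | nil => simp [search] at h
    | cons x cert =>
      rw [search, Bool.cond_eq_ite] at h
      split_ifs at h with hx
      · exact close hσ hx
      · simp at h
  | cons q qs ih =>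
    cases cert with
    | nil => simp [search] at h
    | cons x cert =>
      rw [search, Bool.cond_eq_ite] at h
      split_ifs at h with hx
      · exact close hσ hx
      · obtain ⟨r, hr⟩ := Option.isSome_iff_exists.1 h
        obtain ⟨t, ht, htr⟩ := Option.bind_eq_some_iff.1 hr
        rcases htot (q : F) with hq | hq
        · exact ih (List.forall_mem_cons.2 ⟨hq, hσ⟩) (by rw [ht]; rfl)
        · exact ih (List.forall_mem_cons.2 ⟨hq, hσ⟩) (by rw [htr]; rfl)

end Soundness

theorem exists_square_progression (p : ℕ) [Fact p.Prime] (hp : 619 ≤ p) :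
    ∃ a d : ZMod p, d ≠ 0 ∧ ∀ i : ℕ, i < 7 → IsSquare (a + i * d) := by
  have hchar : ringChar (ZMod p) ≠ 2 := by rw [ZMod.ringChar_zmod_n]; omega
  obtain ⟨g, hgsq⟩ := FiniteField.exists_nonsquare hchar
  have hg : g ≠ 0 := by
    rintro rfl
    exact hgsq IsSquare.zero
  have htot (x : ZMod p) : HasSign g false x ∨ HasSign g true x := by
    by_cases hx : IsSquare x
    · exact .inl (by simpa [HasSign] using hx)
    · refine .inr ?_
      have hx0 : x ≠ 0 := by
        rintro rfl
        exact hx IsSquare.zero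
      have h1 := quadraticChar_neg_one_iff_not_isSquare.2 hgsq
      have h2 := quadraticChar_neg_one_iff_not_isSquare.2 hx
      have h3 : quadraticChar (ZMod p) (g * x) = 1 := by rw [map_mul, h1, h2]; norm_num
      simpa [HasSign] using (quadraticChar_one_iff_isSquare (mul_ne_zero hg hx0)).1 h3
  have hprog : ∃ (a : ZMod p) (d : ℕ) (s : Bool), 0 < d ∧ d < 619 ∧
      ∀ i : ℕ, i < 7 → HasSign g s (a + i * d) := by
    rcases htot (-1) with h | h
    · exact exists_progression_of_search hg htot h (by simp) search_certPos
    · exact exists_progression_of_search hg htot h (by simp) search_certNeg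
  obtain ⟨a, d, s, hd0, hd, h⟩ := hprog
  have hd' : (d : ZMod p) ≠ 0 := by
    rw [Ne, ZMod.natCast_eq_zero_iff]
    exact fun hdvd => absurd (Nat.le_of_dvd hd0 hdvd) (by omega)
  refine ⟨(if s then g else 1) * a, (if s then g else 1) * d,
    mul_ne_zero (by split_ifs <;> simp [hg]) hd', fun i hi => ?_⟩
  have hi := h i hi
  rw [HasSign] at hi
  convert hi using 1
  ring

end SquareProgression

theorem card_add_self_progression_le {R : Type*} [CommRing R] [DecidableEq R] (a d : R) (n : ℕ) :
    ((Finset.range n).image (fun i : ℕ => a + i * d) +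
      (Finset.range n).image (fun i : ℕ => a + i * d)).card ≤ 2 * n - 1 := by
  have hsub : (Finset.range n).image (fun i : ℕ => a + i * d) +
      (Finset.range n).image (fun i : ℕ => a + i * d) ⊆
      (Finset.range (2 * n - 1)).image (fun i : ℕ => 2 * a + i * d) := by
    intro x hx
    obtain ⟨_, hy, _, hz, rfl⟩ := Finset.mem_add.1 hx
    obtain ⟨i, hi, rfl⟩ := Finset.mem_image.1 hy
    obtain ⟨j, hj, rfl⟩ := Finset.mem_image.1 hz
    rw [Finset.mem_range] at hi hj
    exact Finset.mem_image.2 ⟨i + j, Finset.mem_range.2 (by omega), by push_cast; ring⟩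
  simpa using (Finset.card_le_card hsub).trans Finset.card_image_le

/-- For every prime `p ≥ 619`, `N_7(ℤ_p) = 13`. -/
theorem sqSumsetMin_zmod_7 (p : ℕ) (hp : p.Prime) (hge : 619 ≤ p) :
    sqSumsetMin (ZMod p) 7 = 13 := by
  have : Fact p.Prime := ⟨hp⟩
  have hlower (A : Finset (ZMod p)) (hA : A.card = 7) : 13 ≤ (A + A).card := by
    have hne : A.Nonempty := Finset.card_pos.1 (by omega)
    have h := ZMod.cauchy_davenport hp hne hne
    rw [hA, min_eq_right (by omega)] at h
    exact h
  obtain ⟨a, d, hd, hsq⟩ := SquareProgression.exists_square_progression p hge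
  let A : Finset (ZMod p) := (Finset.range 7).image fun i : ℕ => a + i * d
  have hcard : A.card = 7 := by
    refine (Finset.card_image_of_injOn fun i hi j hj hij => ?_).trans (Finset.card_range 7)
    simp only [Finset.coe_range, Set.mem_Iio] at hi hj
    have hcast : (i : ZMod p) = j := mul_right_cancel₀ hd (add_left_cancel hij)
    have hmod := (ZMod.natCast_eq_natCast_iff' i j p).1 hcast
    rwa [Nat.mod_eq_of_lt (by omega), Nat.mod_eq_of_lt (by omega)] at hmod
  have hmem : 13 ∈ {k | ∃ A : Finset (ZMod p),
      (∀ a ∈ A, IsSquare a) ∧ A.card = 7 ∧ (A + A).card = k} := by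
    refine ⟨A, fun x hx => ?_, hcard,
      le_antisymm (card_add_self_progression_le a d 7) (hlower A hcard)⟩
    obtain ⟨i, hi, rfl⟩ := Finset.mem_image.1 hx
    exact hsq i (Finset.mem_range.1 hi)
  refine le_antisymm (Nat.sInf_le hmem) (le_csInf ⟨13, hmem⟩ ?_)
  rintro k ⟨B, -, hB, rfl⟩
  exact hlower B hB
end

section
/- For every prime p ≥ 11, the minimum N_6(ℤ_p) of |A+A| over all 6-element subsets A of the set of squares of ℤ/pℤ is given by: N_6(ℤ_p) = 11 if p ∈ {11, 53, 61, 67, 71, 73, 79, 83, 89, 97, 101, 103, 107, 109, 127, 131, 137} or p ≥ 149; N_6(ℤ_p) = 12 if p ∈ {17, 23, 41, 43, 47, 113, 139}; N_6(ℤ_p) = 13 if p ∈ {13, 19, 31, 37, 59}; and N_6(ℤ_p) = 14 if p = 29. -/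
open Pointwise

/-! ### Sets of six squares with few sums -/

lemma sqSumsetMin_eq {R : Type*} [CommRing R] [DecidableEq R] {n k : ℕ}
    (hle : ∃ A : Finset R, (∀ a ∈ A, IsSquare a) ∧ A.card = n ∧ (A + A).card ≤ k)
    (hge : ∀ A : Finset R, (∀ a ∈ A, IsSquare a) → A.card = n → k ≤ (A + A).card) :
    sqSumsetMin R n = k := by
  obtain ⟨A, hA, hn, hk⟩ := hle
  refine le_antisymm (Nat.sInf_le ⟨A, hA, hn, hk.antisymm (hge A hA hn)⟩) ?_
  refine le_csInf ⟨_, A, hA, hn, rfl⟩ ?_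
  rintro _ ⟨B, hB, hBn, rfl⟩
  exact hge B hB hBn

/-- The finite set of squares in `ZMod p` given by its square roots. -/
def squaresOfRoots (p : ℕ) (B : Finset ℕ) : Finset (ZMod p) :=
  B.image fun r : ℕ => (r * r : ZMod p)

lemma exists_of_roots {p k : ℕ} (B : Finset ℕ)
    (h : (squaresOfRoots p B).card = 6 ∧ (squaresOfRoots p B + squaresOfRoots p B).card ≤ k) :
    ∃ A : Finset (ZMod p), (∀ a ∈ A, IsSquare a) ∧ A.card = 6 ∧ (A + A).card ≤ k := by
  refine ⟨_, ?_, h⟩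
  intro a ha
  obtain ⟨r, -, rfl⟩ := Finset.mem_image.1 ha
  exact ⟨r, rfl⟩

section Bounds

variable {p : ℕ} [Fact p.Prime]

/-- A six-term arithmetic progression of squares realises the value `11`. -/
lemma card_add_le_eleven_of_progression (hp : 11 ≤ p) {a d : ZMod p} (hd : d ≠ 0)
    (hsq : ∀ j < 6, IsSquare (a + (j : ℕ) * d)) :
    ∃ A : Finset (ZMod p), (∀ x ∈ A, IsSquare x) ∧ A.card = 6 ∧ (A + A).card ≤ 11 := by
  classical
  refine ⟨(Finset.range 6).image fun j : ℕ => a + j * d, ?_, ?_, ?_⟩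
  · simpa using hsq
  · rw [Finset.card_image_of_injOn, Finset.card_range]
    intro i hi j hj hij
    have hi : i < 6 := by simpa using hi
    have hj : j < 6 := by simpa using hj
    have h : (i : ZMod p) = j := mul_right_cancel₀ hd (add_left_cancel hij)
    rw [ZMod.natCast_eq_natCast_iff] at h
    exact Nat.ModEq.eq_of_lt_of_lt h (by omega) (by omega)
  · have hsub : ((Finset.range 6).image fun j : ℕ => a + j * d) +
        ((Finset.range 6).image fun j : ℕ => a + j * d) ⊆
        (Finset.range 11).image fun j : ℕ => 2 * a + j * d := by
      intro x hx
      obtain ⟨y, hy, z, hz, rfl⟩ := Finset.mem_add.1 hx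
      obtain ⟨i, hi, rfl⟩ := Finset.mem_image.1 hy
      obtain ⟨j, hj, rfl⟩ := Finset.mem_image.1 hz
      rw [Finset.mem_range] at hi hj
      refine Finset.mem_image.2 ⟨i + j, Finset.mem_range.2 (by omega), ?_⟩
      push_cast
      ring
    exact (Finset.card_le_card hsub).trans (Finset.card_image_le.trans (by simp))

lemma sqSumsetMin_eq_eleven (hp : 11 ≤ p)
    (hle : ∃ A : Finset (ZMod p), (∀ a ∈ A, IsSquare a) ∧ A.card = 6 ∧ (A + A).card ≤ 11) :
    sqSumsetMin (ZMod p) 6 = 11 := by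
  refine sqSumsetMin_eq hle fun A _ hA => ?_
  have hne : A.Nonempty := Finset.card_pos.1 (by omega)
  have := ZMod.cauchy_davenport (Fact.out : p.Prime) hne hne
  rw [hA] at this
  omega

/-- Six elements with at most `14` pairwise sums contain two disjoint pairs of equal sum. -/
lemma exists_add_eq_add {G : Type*} [AddCommGroup G] [DecidableEq G] {A : Finset G}
    (hA : A.card = 6) (h : (A + A).card ≤ 14) :
    ∃ a ∈ A, ∃ b ∈ A, ∃ c ∈ A, ∃ d ∈ A,
      a ≠ b ∧ c ≠ d ∧ a ≠ c ∧ a ≠ d ∧ b ≠ c ∧ b ≠ d ∧ a + b = c + d := by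
  obtain ⟨s, -, hs⟩ := Finset.exists_lt_card_fiber_of_mul_lt_card_of_maps_to (s := A.offDiag)
    (t := A + A) (f := fun x => x.1 + x.2) (n := 2)
    (fun x hx => Finset.add_mem_add (Finset.mem_offDiag.1 hx).1 (Finset.mem_offDiag.1 hx).2.1)
    (by rw [Finset.offDiag_card, hA]; omega)
  obtain ⟨⟨a, b⟩, hab⟩ := Finset.card_pos.1 (two_pos.trans hs)
  obtain ⟨⟨c, d⟩, hcd, hne⟩ := Finset.exists_mem_notMem_of_card_lt_card
    (lt_of_le_of_lt (Finset.card_le_two (a := (a, b)) (b := (b, a))) hs)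
  simp only [Finset.mem_filter, Finset.mem_offDiag, Finset.mem_insert, Finset.mem_singleton,
    Prod.mk.injEq, not_or, not_and] at hab hcd hne
  obtain ⟨⟨ha, hb, hab⟩, rfl⟩ := hab
  obtain ⟨⟨hc, hd, hcd⟩, hsum⟩ := hcd
  refine ⟨a, ha, b, hb, c, hc, d, hd, hab, hcd, ?_, ?_, ?_, ?_, hsum.symm⟩
  · rintro rfl
    exact hne.1 rfl (add_left_cancel hsum)
  · rintro rfl
    exact hne.2 (add_right_cancel (hsum.trans (add_comm _ _))) rfl
  · rintro rfl
    exact hne.2 rfl (add_left_cancel (hsum.trans (add_comm _ _)))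
  · rintro rfl
    exact hne.1 (add_right_cancel hsum) rfl

/-- A six-element set of squares with few sums may be rescaled so that it contains `1` and a
nontrivial solution of `1 + b = c + d`, with `b` minimal under such rescalings. -/
lemma exists_normalized {A : Finset (ZMod p)} (hsq : ∀ a ∈ A, IsSquare a) (hA : A.card = 6)
    (h : (A + A).card ≤ 14) :
    ∃ A' : Finset (ZMod p), (∀ a ∈ A', IsSquare a) ∧ A'.card = 6 ∧ (A' + A').card = (A + A).card ∧
      1 ∈ A' ∧ ∃ b ∈ A', ∃ c ∈ A', ∃ d ∈ A', b ≠ 1 ∧ c ≠ 1 ∧ d ≠ 1 ∧ c ≠ d ∧ 1 + b = c + d ∧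
        (b ≠ 0 → b.val ≤ (1 / b).val) ∧ (d ≠ 0 → b.val ≤ (c / d).val) ∧
        (c ≠ 0 → b.val ≤ (d / c).val) := by
  let P (a b c d : ZMod p) : Prop := a ∈ A ∧ a ≠ 0 ∧ b ∈ A ∧ c ∈ A ∧ d ∈ A ∧
    b ≠ a ∧ c ≠ a ∧ d ≠ a ∧ c ≠ d ∧ b ≠ c ∧ b ≠ d ∧ a + b = c + d
  have hex : ∃ n a b c d, P a b c d ∧ (b / a).val = n := by
    obtain ⟨a, ha, b, hb, c, hc, d, hd, hab, hcd, hac, had, hbc, hbd, hsum⟩ :=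
      exists_add_eq_add hA h
    by_cases h0 : a = 0
    · exact ⟨_, b, a, c, d, ⟨hb, h0 ▸ hab.symm, ha, hc, hd, hab, hbc.symm, hbd.symm, hcd, hac, had,
        (add_comm _ _).trans hsum⟩, rfl⟩
    · exact ⟨_, a, b, c, d, ⟨ha, h0, hb, hc, hd, hab.symm, hac.symm, had.symm, hcd, hbc, hbd,
        hsum⟩, rfl⟩
  classical
  obtain ⟨a, b, c, d, ⟨ha, h0, hb, hc, hd, hba, hca, hda, hcd, hbc, hbd, hsum⟩, hval⟩ :=
    Nat.find_spec hex
  have hmin {a' b' c' d' : ZMod p} (h' : P a' b' c' d') : (b / a).val ≤ (b' / a').val :=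
    hval ▸ Nat.find_min' hex ⟨a', b', c', d', h', rfl⟩
  have hinj : Function.Injective (AddMonoidHom.mulLeft a⁻¹) :=
    fun x y hxy => mul_left_cancel₀ (inv_ne_zero h0) hxy
  have hmem {x : ZMod p} (hx : x ∈ A) : a⁻¹ * x ∈ A.image (AddMonoidHom.mulLeft a⁻¹) :=
    Finset.mem_image_of_mem _ hx
  have hone {x : ZMod p} (hx : x ≠ a) : a⁻¹ * x ≠ 1 := by
    rw [Ne, inv_mul_eq_one₀ h0]
    exact hx.symm
  refine ⟨A.image (AddMonoidHom.mulLeft a⁻¹), ?_, ?_, ?_, ?_, _, hmem hb, _, hmem hc, _, hmem hd,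
    hone hba, hone hca, hone hda, fun h => hcd (hinj h), ?_, fun hb0 => ?_, fun hd0 => ?_,
    fun hc0 => ?_⟩
  · intro x hx
    obtain ⟨y, hy, rfl⟩ := Finset.mem_image.1 hx
    exact (hsq a ha).inv.mul (hsq y hy)
  · rw [Finset.card_image_of_injective _ hinj, hA]
  · rw [← Finset.image_add, Finset.card_image_of_injective _ hinj]
  · simpa [h0] using hmem ha
  · rw [← mul_add, ← hsum, mul_add, inv_mul_cancel₀ h0]
  · rw [← div_eq_inv_mul, one_div_div]
    exact hmin ⟨hb, right_ne_zero_of_mul hb0, ha, hc, hd, hba.symm, hbc.symm, hbd.symm, hcd,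
      hca.symm, hda.symm, (add_comm _ _).trans hsum⟩
  · rw [mul_div_mul_left _ _ (inv_ne_zero h0), ← div_eq_inv_mul]
    exact hmin ⟨hd, right_ne_zero_of_mul hd0, hc, ha, hb, hcd, hda.symm, hbd, hba.symm, hca,
      hbc.symm, (add_comm _ _).trans hsum.symm⟩
  · rw [mul_div_mul_left _ _ (inv_ne_zero h0), ← div_eq_inv_mul]
    exact hmin ⟨hc, right_ne_zero_of_mul hc0, hd, ha, hb, hcd.symm, hca.symm, hbc, hba.symm, hda,
      hbd.symm, hsum.symm⟩

end Bounds

/-! ### Exhaustive search for the lower bounds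

The operations on `ℕ` below are not written through type class instances, so that the kernel
evaluates them quickly. -/

/-- Whether `i` belongs to the set with bit mask `S`. -/
def hasBit (S i : ℕ) : Bool := Nat.beq (Nat.land 1 (Nat.shiftRight S i)) 1

/-- Insert `i` into the set with bit mask `S`. -/
def addBit (S i : ℕ) : ℕ := Nat.lor S (Nat.shiftLeft 1 i)

/-- Insert the sums `x + b` (mod `p`), for `b` in the list, into the set with bit mask `S` and
cardinality `c`. Succeed as soon as there are more than `K` elements, and pass the resulting mask
and cardinality to `k` otherwise. -/
def insertSums (p K x : ℕ) (k : ℕ → ℕ → Bool) : List ℕ → ℕ → ℕ → Bool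
  | [], S, c => k S c
  | b :: B, S, c =>
    bif hasBit S (Nat.mod (Nat.add x b) p) then insertSums p K x k B S c
    else bif Nat.ble K c then true
    else insertSums p K x k B (addBit S (Nat.mod (Nat.add x b) p)) (Nat.succ c)

/-- The residues of the squares modulo `p`. -/
def squareResidues (p : ℕ) : List ℕ := (List.range (p / 2 + 1)).map fun r => r * r % p

/-- Every extension of `B` by `n` further elements of `Q` has more than `K` sums, where `S` and `c`
are the mask and the cardinality of the sums already known. -/
def noExtension (p K : ℕ) (Q : List ℕ) : ℕ → List ℕ → ℕ → ℕ → Bool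
  | 0, _, _, _ => false
  | n + 1, B, S, c => Q.all fun x => insertSums p K x
      (fun S c => B.contains x || noExtension p K Q n (x :: B) S c) (x :: B) S c

/-- As `noExtension` with `n = 2`, after moving the elements of the first list to the second. -/
def noExtensionOf (p K : ℕ) (Q : List ℕ) : List ℕ → List ℕ → ℕ → ℕ → Bool
  | [], B, S, c => noExtension p K Q 2 B S c
  | x :: L, B, S, c => insertSums p K x (noExtensionOf p K Q L (x :: B)) (x :: B) S c

/-- The quotient of `x` by `y` modulo the prime `p`. -/
def ratio (p x y : ℕ) : ℕ := Nat.mod (Nat.mul x (Nat.pow y (Nat.sub p 2))) p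

/-- `b` is at most the quotient of `x` by `y` modulo `p`, if this quotient exists. -/
def leRatio (p b x y : ℕ) : Bool := Nat.beq y 0 || Nat.ble b (ratio p x y)

/-- If `b` is an element of `Q` other than `1`, and minimal as in `exists_normalized`, then every
set of six elements of `Q` containing `1, c, d, b` has more than `K` sums. -/
def noExtensionOfPair (p K : ℕ) (Q : List ℕ) (c d b : ℕ) : Bool :=
  !hasBit (Q.foldr (fun x S => addBit S x) 0) b || Nat.beq b 1 ||
    !(leRatio p b 1 b && leRatio p b c d && leRatio p b d c) ||
    noExtensionOf p K Q [1, c, d, b] [] 0 0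

/-- Every set of six elements of `Q` containing `1` and a nontrivial solution of `1 + b = c + d`,
with `b` minimal as in `exists_normalized`, has more than `K` sums. -/
def noSmallSumset (p K : ℕ) (Q : List ℕ) : Bool :=
  Q.all fun c => Nat.beq c 1 || Q.all fun d => Nat.beq d 1 || Nat.ble d c ||
    noExtensionOfPair p K Q c d (Nat.mod (Nat.add (Nat.add c d) (Nat.sub p 1)) p)

lemma hasBit_eq_testBit (S i : ℕ) : hasBit S i = S.testBit i := by
  change Nat.beq (1 &&& (S >>> i)) 1 = Nat.testBit S i
  rw [Nat.testBit, Nat.one_and_eq_mod_two]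
  rcases Nat.mod_two_eq_zero_or_one (S >>> i) with h | h <;> rw [h] <;> rfl

lemma testBit_addBit (S i j : ℕ) : (addBit S i).testBit j = (S.testBit j || decide (i = j)) := by
  change (S ||| 1 <<< i).testBit j = _
  rw [Nat.testBit_lor, Nat.one_shiftLeft, Nat.testBit_two_pow]

lemma hasBit_foldr_addBit {Q : List ℕ} {b : ℕ} (hb : b ∈ Q) :
    hasBit (Q.foldr (fun x S => addBit S x) 0) b = true := by
  rw [hasBit_eq_testBit]
  induction Q with
  | nil => simp at hb
  | cons x Q ih =>
    rw [List.foldr_cons, testBit_addBit, Bool.or_eq_true, decide_eq_true_iff]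
    rcases List.mem_cons.1 hb with rfl | hb
    exacts [.inr rfl, .inl (ih hb)]

section Search

variable {p : ℕ} [Fact p.Prime]

/-- `S` is the bit mask of a subset of `T` with `c` elements. -/
def IsMask (T : Finset (ZMod p)) (S c : ℕ) : Prop :=
  ∃ U ⊆ T, U.card = c ∧ ∀ i < p, S.testBit i ↔ (i : ZMod p) ∈ U

lemma IsMask.insert {T : Finset (ZMod p)} {S c i : ℕ} (h : IsMask T S c) (hi : i < p)
    (hT : (i : ZMod p) ∈ T) (hS : S.testBit i = false) : IsMask T (addBit S i) (c + 1) := by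
  obtain ⟨U, hU, rfl, hbit⟩ := h
  have hn : (i : ZMod p) ∉ U := by
    rw [← hbit i hi, hS]
    simp
  refine ⟨Insert.insert (i : ZMod p) U, Finset.insert_subset hT hU,
    Finset.card_insert_of_notMem hn, fun j hj => ?_⟩
  rw [testBit_addBit, Bool.or_eq_true, hbit j hj, Finset.mem_insert, or_comm]
  refine or_congr ?_ Iff.rfl
  rw [decide_eq_true_iff, ZMod.natCast_eq_natCast_iff]
  exact ⟨fun h => h ▸ rfl, fun h => (Nat.ModEq.eq_of_lt_of_lt h hj hi).symm⟩

lemma lt_card_of_insertSums {T : Finset (ZMod p)} {K x : ℕ} {k : ℕ → ℕ → Bool}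
    (hk : ∀ S c, IsMask T S c → k S c = true → K < T.card) :
    ∀ (B : List ℕ) (S c : ℕ), (∀ b ∈ B, (x : ZMod p) + b ∈ T) → IsMask T S c →
      insertSums p K x k B S c = true → K < T.card
  | [], S, c, _, hS, h => hk S c hS h
  | b :: B, S, c, hB, hS, h => by
    have hB' : ∀ b ∈ B, (x : ZMod p) + b ∈ T := fun b hb => hB b (List.mem_cons_of_mem _ hb)
    have hT : (((x + b) % p : ℕ) : ZMod p) ∈ T := by simpa using hB b (by simp)
    have hlt : (x + b) % p < p := Nat.mod_lt _ (Fact.out : p.Prime).pos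
    rw [insertSums, hasBit_eq_testBit] at h
    change (bif S.testBit ((x + b) % p) then insertSums p K x k B S c else bif Nat.ble K c then true
      else insertSums p K x k B (addBit S ((x + b) % p)) (c + 1)) = true at h
    cases ht : S.testBit ((x + b) % p) with
    | true =>
      rw [ht] at h
      exact lt_card_of_insertSums hk B S c hB' hS h
    | false =>
      have hS' := hS.insert hlt hT ht
      rw [ht] at h
      cases hc : Nat.ble K c with
      | true =>
        obtain ⟨U, hU, hcard, -⟩ := hS'
        have := Finset.card_le_card hU
        have := Nat.le_of_ble_eq_true hc
        omega
      | false =>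
        rw [hc] at h
        exact lt_card_of_insertSums hk B _ _ hB' hS' h

lemma val_mem_squareResidues {x : ZMod p} (hx : IsSquare x) : x.val ∈ squareResidues p := by
  obtain ⟨y, rfl⟩ := hx
  refine List.mem_map.2 ⟨y.valMinAbs.natAbs, ?_, ?_⟩
  · have := ZMod.natAbs_valMinAbs_le y
    exact List.mem_range.2 (by omega)
  · rw [← ZMod.val_natCast]
    congr 1
    have := congrArg (Int.cast : ℤ → ZMod p) (Int.natAbs_mul_self (a := y.valMinAbs))
    rwa [Int.cast_mul, ZMod.coe_valMinAbs, Int.cast_natCast] at this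

variable {A : Finset (ZMod p)} {K : ℕ} {Q : List ℕ}

lemma add_mem_of_cons {x : ℕ} {B : List ℕ} (hx : (x : ZMod p) ∈ A)
    (hB : ∀ b ∈ B, (b : ZMod p) ∈ A) : ∀ b ∈ x :: B, (x : ZMod p) + b ∈ A + A := by
  rintro b (_ | ⟨_, hb⟩)
  exacts [Finset.add_mem_add hx hx, Finset.add_mem_add hx (hB b hb)]

lemma lt_card_of_noExtension (hQ : ∀ a ∈ A, a.val ∈ Q) :
    ∀ (n : ℕ) (B : List ℕ) (S c : ℕ), (∀ b ∈ B, (b : ZMod p) ∈ A) → B.length + n = A.card →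
      IsMask (A + A) S c → noExtension p K Q n B S c = true → K < (A + A).card
  | 0, _, _, _, _, _, _, h => by simp [noExtension] at h
  | n + 1, B, S, c, hB, hn, hS, h => by
    have hcard : (B.map (Nat.cast : ℕ → ZMod p)).toFinset.card < A.card :=
      (List.toFinset_card_le _).trans_lt (by rw [List.length_map]; omega)
    obtain ⟨x, hx, hxB⟩ := Finset.exists_mem_notMem_of_card_lt_card hcard
    have hcast : (x.val : ZMod p) = x := ZMod.natCast_rightInverse x
    have hxA : (x.val : ZMod p) ∈ A := by rwa [hcast]
    have hnot : x.val ∉ B := fun hmem =>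
      hxB (List.mem_toFinset.2 (List.mem_map.2 ⟨_, hmem, hcast⟩))
    rw [noExtension, List.all_eq_true] at h
    refine lt_card_of_insertSums (fun S' c' hS' h' => ?_) _ _ _ (add_mem_of_cons hxA hB) hS
      (h x.val (hQ x hx))
    rw [Bool.or_eq_true, List.contains_iff_mem] at h'
    refine lt_card_of_noExtension hQ n _ S' c' ?_ (by rw [List.length_cons]; omega) hS'
      (h'.resolve_left hnot)
    rintro b (_ | ⟨_, hb⟩)
    exacts [hxA, hB b hb]

lemma lt_card_of_noExtensionOf (hQ : ∀ a ∈ A, a.val ∈ Q) :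
    ∀ (L B : List ℕ) (S c : ℕ), (∀ b ∈ L, (b : ZMod p) ∈ A) → (∀ b ∈ B, (b : ZMod p) ∈ A) →
      L.length + B.length + 2 = A.card → IsMask (A + A) S c →
      noExtensionOf p K Q L B S c = true → K < (A + A).card
  | [], B, S, c, _, hB, hn, hS, h =>
    lt_card_of_noExtension hQ 2 B S c hB (by simpa using hn) hS h
  | x :: L, B, S, c, hL, hB, hn, hS, h => by
    have hxA : (x : ZMod p) ∈ A := hL x (by simp)
    refine lt_card_of_insertSums (fun S' c' hS' h' => ?_) _ _ _ (add_mem_of_cons hxA hB) hS h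
    refine lt_card_of_noExtensionOf hQ L _ S' c' (fun b hb => hL b (List.mem_cons_of_mem _ hb)) ?_
      (by rw [List.length_cons] at hn ⊢; omega) hS' h'
    rintro b (_ | ⟨_, hb⟩)
    exacts [hxA, hB b hb]

lemma ratio_val (hp : 2 < p) (x : ZMod p) {y : ZMod p} (hy : y ≠ 0) :
    ratio p x.val y.val = (x / y).val := by
  change x.val * y.val ^ (p - 2) % p = _
  rw [← ZMod.val_natCast]
  congr 1
  have hpow : y ^ (p - 2) * y = 1 := by
    rw [← pow_succ, show p - 2 + 1 = p - 1 by omega, ZMod.pow_card_sub_one_eq_one hy]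
  push_cast
  rw [ZMod.natCast_rightInverse x, ZMod.natCast_rightInverse y, div_eq_mul_inv,
    eq_inv_of_mul_eq_one_left hpow]

lemma leRatio_val (hp : 2 < p) {b x y : ZMod p} (h : y ≠ 0 → b.val ≤ (x / y).val) :
    leRatio p b.val x.val y.val = true := by
  rw [leRatio, Bool.or_eq_true, Nat.beq_eq, ZMod.val_eq_zero]
  refine or_iff_not_imp_left.2 fun hy => Nat.ble_eq_true_of_le ?_
  rw [ratio_val hp x hy]
  exact h hy

lemma lt_card_of_noSmallSumset (hp : 2 < p) (hK : K ≤ 14) (hQ : squareResidues p = Q)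
    (h : noSmallSumset p K Q = true) (hsq : ∀ a ∈ A, IsSquare a) (hA : A.card = 6) :
    K < (A + A).card := by
  by_contra! hle
  obtain ⟨A', hsq', hA', hcard, h1, b, hb, c, hc, d, hd, hb1, hc1, hd1, hcd, hsum, hmb, hmd, hmc⟩ :=
    exists_normalized hsq hA (hle.trans hK)
  refine hle.not_gt (hcard ▸ ?_)
  clear hcard
  wlog hlt : c.val < d.val generalizing c d
  · refine this d hd c hc hd1 hc1 hcd.symm (hsum.trans (add_comm _ _)) hmc hmd ?_
    have : c.val ≠ d.val := fun h => hcd (ZMod.val_injective p h)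
    omega
  have hQ : ∀ a ∈ A', a.val ∈ Q := fun a ha => hQ ▸ val_mem_squareResidues (hsq' a ha)
  have hcast (x : ZMod p) : (x.val : ZMod p) = x := ZMod.natCast_rightInverse x
  have hne {x : ZMod p} (hx : x ≠ 1) : ¬ Nat.beq x.val 1 = true := fun h =>
    hx (by rw [← hcast x, Nat.eq_of_beq_eq_true h, Nat.cast_one])
  have hone : (1 : ZMod p).val = 1 := ZMod.val_one'' (by omega)
  have hval : (c.val + d.val + (p - 1)) % p = b.val := by
    rw [← ZMod.val_natCast]
    congr 1
    rw [Nat.cast_add, Nat.cast_add, hcast, hcast, ← hsum, Nat.cast_sub (by omega)]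
    simp
  simp only [noSmallSumset, List.all_eq_true, Bool.or_eq_true] at h
  have h := (h c.val (hQ c hc)).resolve_left (hne hc1) d.val (hQ d hd)
  have h := h.resolve_left (not_or.2 ⟨hne hd1, fun h => hlt.not_ge (Nat.le_of_ble_eq_true h)⟩)
  change noExtensionOfPair p K Q c.val d.val ((c.val + d.val + (p - 1)) % p) = true at h
  have hrb := leRatio_val hp hmb
  rw [hone] at hrb
  rw [hval, noExtensionOfPair, hasBit_foldr_addBit (hQ b hb), hrb, leRatio_val hp hmd,
    leRatio_val hp hmc, Bool.or_eq_true, Bool.or_eq_true, Bool.or_eq_true] at h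
  have h := (or_assoc.1 h).resolve_left (by simpa using hne hb1)
  refine lt_card_of_noExtensionOf hQ _ _ _ _ ?_ (by simp) (by simp [hA'])
    ⟨∅, Finset.empty_subset _, rfl, by simp⟩ (h.resolve_left (by simp))
  simp [hcast, h1, hb, hc, hd]

end Search

/-! ### Progressions of constant quadratic character for large primes -/

/-- A decision tree branching on the quadratic characters of successive primes, whose leaves are
the six-term progressions `a, a + d, …, a + 5 * d`. -/
inductive ProgressionTree
  | leaf (a : ℤ) (d : ℕ)
  | node (l r : ProgressionTree)

/-- The sign encoded by a Boolean. -/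
def boolSign (b : Bool) : ℤ := bif b then -1 else 1

/-- Divide `m` by `q` at most `n` times, multiplying the sign `c` by the sign `b` each time. -/
def stripPrime (q : ℕ) (b : Bool) : ℕ → ℕ × Bool → ℕ × Bool
  | 0, x => x
  | n + 1, x => if x.1 % q = 0 then stripPrime q b n (x.1 / q, xor x.2 b) else x

/-- `z` is zero, or has character `c` according to the characters in `L` of primes and the
character `s` of `-1`. -/
def hasCharacter (s : Bool) (L : List (ℕ × Bool)) (c : Bool) (z : ℤ) : Bool :=
  decide (z = 0) || decide (L.foldl (fun x q => stripPrime q.1 q.2 9 x)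
    (z.natAbs, decide (z < 0) && s) = (1, c))

/-- The progressions at the leaves of the tree have constant character. The list `P` consists of
the primes to branch on, and `L` of the characters known already. -/
def checkTree (s : Bool) : List ℕ → List (ℕ × Bool) → ProgressionTree → Bool
  | _, L, .leaf a d => decide (0 < d) && decide (d < 149) && [false, true].any fun c =>
      (List.range 6).all fun j => hasCharacter s L c (a + j * d)
  | [], _, .node _ _ => false
  | q :: P, L, .node l r =>
      checkTree s P (L ++ [(q, false)]) l && checkTree s P (L ++ [(q, true)]) r

/-- The tree used when `-1` is a square. -/
def treeOfIsSquare : ProgressionTree :=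
  .node (.node (.leaf (-4) 1) (.node (.node (.leaf (-10) 3) (.node (.leaf (-11) 3) (.node (.node
    (.leaf (-25) 4) (.node (.leaf (-90) 13) (.node (.node (.node (.leaf (-42) 11) (.leaf (-207)
    75)) (.leaf (-132) 15)) (.leaf (-81) 12)))) (.node (.node (.leaf (-21) 1) (.node (.leaf
    (-256) 47) (.leaf (-81) 12))) (.node (.leaf (-90) 13) (.node (.leaf (-408) 123) (.leaf (-81)
    12))))))) (.node (.node (.node (.node (.leaf (-18) 1) (.node (.leaf (-28) 3) (.node (.node
    (.leaf (-36) 7) (.node (.leaf (-31) 8) (.leaf (-135) 21))) (.leaf (-322) 113)))) (.leaf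
    (-39) 7)) (.node (.node (.leaf (-18) 1) (.node (.leaf (-66) 17) (.leaf (-105) 24))) (.node
    (.leaf (-33) 8) (.node (.leaf (-66) 17) (.leaf (-105) 24))))) (.node (.node (.node (.leaf
    (-44) 9) (.node (.leaf (-49) 17) (.leaf (-170) 53))) (.leaf (-39) 7)) (.leaf (-50) 17)))))
    (.node (.node (.leaf (-5) 2) (.node (.node (.node (.leaf (-16) 3) (.node (.leaf (-33) 8)
    (.leaf (-100) 37))) (.node (.leaf (-16) 3) (.node (.node (.node (.leaf (-27) 2) (.leaf
    (-133) 29)) (.leaf (-64) 13)) (.leaf (-40) 6)))) (.leaf (-40) 13))) (.node (.node (.node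
    (.leaf (-16) 5) (.node (.node (.leaf (-33) 8) (.leaf (-80) 29)) (.leaf (-30) 2))) (.node
    (.leaf (-21) 5) (.node (.node (.leaf (-25) 4) (.leaf (-34) 10)) (.leaf (-36) 10)))) (.node
    (.node (.leaf (-16) 5) (.node (.leaf (-16) 3) (.node (.leaf (-33) 8) (.leaf (-40) 6))))
    (.node (.leaf (-21) 5) (.node (.node (.node (.leaf (-25) 3) (.node (.leaf (-81) 29) (.leaf
    (-68) 11))) (.leaf (-34) 10)) (.leaf (-36) 10))))))

/-- The tree used when `-1` is not a square. -/
def treeOfNotIsSquare : ProgressionTree :=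
  .node (.node (.node (.leaf 0 1) (.node (.node (.node (.leaf 1 5) (.node (.leaf 2 5) (.node
    (.leaf (-13) 8) (.node (.leaf (-40) 21) (.node (.leaf (-23) 13) (.leaf (-91) 31)))))) (.node
    (.node (.leaf (-5) 11) (.leaf (-17) 6)) (.node (.leaf (-60) 47) (.leaf (-91) 23)))) (.node
    (.node (.leaf 4 7) (.node (.leaf (-15) 8) (.node (.leaf (-21) 8) (.node (.leaf (-40) 21)
    (.leaf (-23) 2))))) (.node (.node (.leaf (-15) 8) (.leaf (-91) 23)) (.node (.leaf (-15) 8)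
    (.node (.leaf (-33) 13) (.leaf (-21) 2))))))) (.node (.node (.node (.leaf (-3) 7) (.node
    (.leaf 1 3) (.leaf (-75) 31))) (.node (.leaf (-3) 7) (.leaf (-15) 4))) (.node (.node (.leaf
    (-10) 7) (.node (.node (.leaf 13 1) (.leaf (-17) 6)) (.leaf (-27) 7))) (.node (.leaf (-10)
    7) (.node (.node (.leaf (-7) 8) (.node (.leaf (-114) 23) (.leaf (-19) 7))) (.leaf (-27)
    7)))))) (.node (.node (.node (.node (.leaf 1 2) (.node (.node (.leaf 1 4) (.leaf (-11) 9))
    (.node (.node (.node (.leaf 15 2) (.leaf (-187) 59)) (.leaf (-6) 11)) (.leaf (-11) 9))))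
    (.node (.node (.leaf 11 1) (.leaf (-35) 11)) (.node (.node (.leaf 12 1) (.leaf (-44) 9))
    (.leaf (-35) 11)))) (.node (.leaf (-8) 3) (.node (.node (.leaf 9 1) (.node (.leaf (-15) 8)
    (.node (.leaf (-21) 8) (.leaf (-22) 1)))) (.leaf (-11) 3)))) (.node (.node (.node (.node
    (.node (.leaf (-3) 4) (.node (.leaf (-119) 31) (.node (.leaf (-46) 19) (.node (.node (.node
    (.leaf (-75) 139) (.leaf (-37) 5)) (.leaf (-153) 61)) (.leaf (-50) 21))))) (.leaf (-32) 19))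
    (.node (.node (.leaf (-3) 4) (.leaf (-11) 9)) (.leaf (-15) 1))) (.node (.node (.leaf (-7) 4)
    (.leaf 1 5)) (.leaf (-15) 4))) (.node (.leaf (-8) 3) (.node (.node (.node (.node (.leaf 9 2)
    (.leaf (-171) 43)) (.leaf (-32) 5)) (.leaf 1 5)) (.leaf (-11) 3)))))

lemma checkTree_treeOfIsSquare :
    checkTree false [2, 3, 5, 7, 11, 13, 17, 19, 23, 29, 31, 37] [] treeOfIsSquare = true := by
  decide +kernel

lemma checkTree_treeOfNotIsSquare :
    checkTree true [2, 3, 5, 7, 11, 13, 17, 19, 23, 29, 31, 37] [] treeOfNotIsSquare = true := by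
  decide +kernel

lemma boolSign_xor (b c : Bool) : boolSign (xor b c) = boolSign b * boolSign c := by
  cases b <;> cases c <;> rfl

section Progression

variable {p : ℕ} [Fact p.Prime] {s : Bool} {L : List (ℕ × Bool)}

lemma quadraticChar_stripPrime {q : ℕ} {b : Bool} (hq : quadraticChar (ZMod p) q = boolSign b)
    (n : ℕ) (x : ℕ × Bool) :
    quadraticChar (ZMod p) ((stripPrime q b n x).1 : ℕ) * boolSign (stripPrime q b n x).2 =
      quadraticChar (ZMod p) (x.1 : ℕ) * boolSign x.2 := by
  induction n generalizing x with
  | zero => rfl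
  | succ n ih =>
    rw [stripPrime]
    split_ifs with h
    · rw [ih, boolSign_xor, ← hq]
      conv_rhs => rw [← Nat.mul_div_cancel' (Nat.dvd_of_mod_eq_zero h), Nat.cast_mul, map_mul]
      ring
    · rfl

lemma quadraticChar_foldl_stripPrime (n : ℕ)
    (hL : ∀ q ∈ L, quadraticChar (ZMod p) (q.1 : ℕ) = boolSign q.2) (x : ℕ × Bool) :
    quadraticChar (ZMod p) ((L.foldl (fun x q => stripPrime q.1 q.2 n x) x).1 : ℕ) *
        boolSign (L.foldl (fun x q => stripPrime q.1 q.2 n x) x).2 =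
      quadraticChar (ZMod p) (x.1 : ℕ) * boolSign x.2 := by
  induction L generalizing x with
  | nil => rfl
  | cons q L ih =>
    rw [List.foldl_cons, ih fun q' hq' => hL q' (List.mem_cons_of_mem _ hq'),
      quadraticChar_stripPrime (hL q (by simp))]

lemma quadraticChar_eq_of_hasCharacter (hs : quadraticChar (ZMod p) (-1) = boolSign s)
    (hL : ∀ q ∈ L, quadraticChar (ZMod p) (q.1 : ℕ) = boolSign q.2) {c : Bool} {z : ℤ}
    (h : hasCharacter s L c z = true) : z = 0 ∨ quadraticChar (ZMod p) z = boolSign c := by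
  rw [hasCharacter, Bool.or_eq_true, decide_eq_true_iff, decide_eq_true_iff] at h
  refine h.imp_right fun h => ?_
  have key := quadraticChar_foldl_stripPrime 9 hL (z.natAbs, decide (z < 0) && s)
  rw [h, Nat.cast_one, map_one, one_mul] at key
  rw [key]
  rcases lt_or_ge z 0 with hz | hz
  · have hcast : (z : ZMod p) = -1 * (z.natAbs : ZMod p) := by
      rw [← Int.cast_natCast, Int.ofNat_natAbs_of_nonpos hz.le]
      simp
    rw [hcast, map_mul, hs, mul_comm]
    simp [hz]
  · have hcast : (z : ZMod p) = (z.natAbs : ZMod p) := by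
      rw [← Int.cast_natCast, Int.natAbs_of_nonneg hz]
    simp [hcast, hz.not_gt, boolSign]

lemma exists_boolSign_eq {x : ZMod p} (hx : x ≠ 0) :
    ∃ b, quadraticChar (ZMod p) x = boolSign b := by
  rcases quadraticChar_dichotomy hx with h | h
  exacts [⟨false, h⟩, ⟨true, h⟩]

lemma exists_progression_of_checkTree (hp : 149 ≤ p)
    (hs : quadraticChar (ZMod p) (-1) = boolSign s) (P : List ℕ)
    (hP : ∀ q ∈ P, 0 < q ∧ q < 149)
    (hL : ∀ q ∈ L, quadraticChar (ZMod p) (q.1 : ℕ) = boolSign q.2) (T : ProgressionTree)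
    (h : checkTree s P L T = true) :
    ∃ (a : ℤ) (d : ℕ) (c : Bool), 0 < d ∧ d < 149 ∧ ∀ j < 6, a + (j : ℕ) * d = 0 ∨
      quadraticChar (ZMod p) ((a + (j : ℕ) * d : ℤ) : ZMod p) = boolSign c := by
  induction T generalizing P L with
  | leaf a d =>
    simp only [checkTree, Bool.and_eq_true, decide_eq_true_iff, List.any_eq_true,
      List.all_eq_true, List.mem_range] at h
    obtain ⟨⟨hd, hd'⟩, c, -, hc⟩ := h
    exact ⟨a, d, c, hd, hd', fun j hj => quadraticChar_eq_of_hasCharacter hs hL (hc j hj)⟩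
  | node l r ihl ihr =>
    cases P with
    | nil => simp [checkTree] at h
    | cons q P =>
      rw [checkTree, Bool.and_eq_true] at h
      obtain ⟨hq0, hq⟩ := hP q (by simp)
      have hqp : (q : ZMod p) ≠ 0 := by
        rw [Ne, ZMod.natCast_eq_zero_iff]
        exact Nat.not_dvd_of_pos_of_lt hq0 (hq.trans_le hp)
      have hP' : ∀ q ∈ P, 0 < q ∧ q < 149 := fun q' hq' => hP q' (List.mem_cons_of_mem _ hq')
      have hL' {b : Bool} (hb : quadraticChar (ZMod p) (q : ℕ) = boolSign b) :
          ∀ q' ∈ L ++ [(q, b)], quadraticChar (ZMod p) (q'.1 : ℕ) = boolSign q'.2 := by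
        intro q' hq'
        rcases List.mem_append.1 hq' with hq' | hq'
        · exact hL q' hq'
        · rw [List.mem_singleton.1 hq', hb]
      obtain ⟨b, hb⟩ := exists_boolSign_eq hqp
      cases b with
      | false => exact ihl P hP' (hL' hb) h.1
      | true => exact ihr P hP' (hL' hb) h.2

lemma exists_card_add_le_eleven (hp : 149 ≤ p) :
    ∃ A : Finset (ZMod p), (∀ a ∈ A, IsSquare a) ∧ A.card = 6 ∧ (A + A).card ≤ 11 := by
  have hchar : ringChar (ZMod p) ≠ 2 := by
    rw [ZMod.ringChar_zmod_n]
    omega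
  have hprog : ∃ (a : ℤ) (d : ℕ) (c : Bool), 0 < d ∧ d < 149 ∧ ∀ j < 6, a + (j : ℕ) * d = 0 ∨
      quadraticChar (ZMod p) ((a + (j : ℕ) * d : ℤ) : ZMod p) = boolSign c := by
    obtain ⟨s, hs⟩ := exists_boolSign_eq (neg_ne_zero.2 (one_ne_zero (α := ZMod p)))
    cases s with
    | false =>
      refine exists_progression_of_checkTree (L := []) hp hs _ ?_ (by simp) _
        checkTree_treeOfIsSquare
      decide
    | true =>
      refine exists_progression_of_checkTree (L := []) hp hs _ ?_ (by simp) _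
        checkTree_treeOfNotIsSquare
      decide
  obtain ⟨a, d, c, hd0, hd, hc⟩ := hprog
  have hdp : (d : ZMod p) ≠ 0 := by
    rw [Ne, ZMod.natCast_eq_zero_iff]
    exact Nat.not_dvd_of_pos_of_lt hd0 (hd.trans_le hp)
  obtain ⟨g, hg⟩ : ∃ g : ZMod p, quadraticChar (ZMod p) g = boolSign c := by
    cases c with
    | false => exact ⟨1, map_one _⟩
    | true => exact quadraticChar_exists_neg_one hchar
  have hsign : boolSign c * boolSign c = 1 := by cases c <;> rfl
  have hg0 : g ≠ 0 := by
    rintro rfl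
    rw [quadraticChar_zero] at hg
    rw [← hg] at hsign
    omega
  refine card_add_le_eleven_of_progression (a := g * a) (d := g * d) (by omega)
    (mul_ne_zero hg0 hdp) fun j hj => ?_
  have heq : g * a + (j : ℕ) * (g * d) = g * ((a + (j : ℕ) * d : ℤ) : ZMod p) := by
    push_cast
    ring
  rw [heq]
  rcases hc j hj with h | h
  · rw [h, Int.cast_zero, mul_zero]
    exact IsSquare.zero
  · have h1 : quadraticChar (ZMod p) (g * ((a + (j : ℕ) * d : ℤ) : ZMod p)) = 1 := by
      rw [map_mul, hg, h, hsign]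
    refine (quadraticChar_one_iff_isSquare fun h0 => ?_).1 h1
    rw [h0, quadraticChar_zero] at h1
    exact zero_ne_one h1

end Progression

/-! ### The values for all primes -/

lemma sqSumsetMin_eq_of_noSmallSumset {p K : ℕ} (B : Finset ℕ) (Q : List ℕ)
    (hB : (squaresOfRoots p B).card = 6 ∧ (squaresOfRoots p B + squaresOfRoots p B).card ≤ K + 1)
    [Fact p.Prime] (hp : 2 < p) (hK : K ≤ 14) (hQ : squareResidues p = Q)
    (h : noSmallSumset p K Q = true) :
    sqSumsetMin (ZMod p) 6 = K + 1 :=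
  sqSumsetMin_eq (exists_of_roots B hB) fun _ hsq hA => lt_card_of_noSmallSumset hp hK hQ h hsq hA

lemma sqSumsetMin_zmod_17_six [Fact (Nat.Prime 17)] : sqSumsetMin (ZMod 17) 6 = 12 := by
  refine sqSumsetMin_eq_of_noSmallSumset (K := 11) {1, 3, 0, 5, 4, 7}
    [0, 1, 4, 9, 16, 8, 2, 15, 13]
    ?_ ?_ ?_ ?_ ?_ <;> decide +kernel

lemma sqSumsetMin_zmod_23_six [Fact (Nat.Prime 23)] : sqSumsetMin (ZMod 23) 6 = 12 := by
  refine sqSumsetMin_eq_of_noSmallSumset (K := 11) {0, 1, 5, 7, 2, 11}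
    [0, 1, 4, 9, 16, 2, 13, 3, 18, 12, 8, 6]
    ?_ ?_ ?_ ?_ ?_ <;> decide +kernel

lemma sqSumsetMin_zmod_41_six [Fact (Nat.Prime 41)] : sqSumsetMin (ZMod 41) 6 = 12 := by
  refine sqSumsetMin_eq_of_noSmallSumset (K := 11) {1, 4, 20, 13, 15, 3}
    [0, 1, 4, 9, 16, 25, 36, 8, 23, 40, 18, 39, 21, 5, 32, 20, 10, 2, 37, 33, 31]
    ?_ ?_ ?_ ?_ ?_ <;> decide +kernel

lemma sqSumsetMin_zmod_43_six [Fact (Nat.Prime 43)] : sqSumsetMin (ZMod 43) 6 = 12 := by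
  refine sqSumsetMin_eq_of_noSmallSumset (K := 11) {1, 7, 21, 4, 8, 17}
    [0, 1, 4, 9, 16, 25, 36, 6, 21, 38, 14, 35, 15, 40, 24, 10, 41, 31, 23, 17, 13, 11]
    ?_ ?_ ?_ ?_ ?_ <;> decide +kernel

lemma sqSumsetMin_zmod_47_six [Fact (Nat.Prime 47)] : sqSumsetMin (ZMod 47) 6 = 12 := by
  refine sqSumsetMin_eq_of_noSmallSumset (K := 11) {0, 1, 7, 12, 2, 10}
    [0, 1, 4, 9, 16, 25, 36, 2, 17, 34, 6, 27, 3, 28, 8, 37, 21, 7, 42, 32, 24, 18, 14, 12]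
    ?_ ?_ ?_ ?_ ?_ <;> decide +kernel

lemma sqSumsetMin_zmod_113_six [Fact (Nat.Prime 113)] : sqSumsetMin (ZMod 113) 6 = 12 := by
  refine sqSumsetMin_eq_of_noSmallSumset (K := 11) {1, 31, 0, 13, 15, 26}
    [0, 1, 4, 9, 16, 25, 36, 49, 64, 81, 100, 8, 31, 56, 83, 112, 30, 63, 98, 22, 61, 102, 32, 77,
      11, 60, 111, 51, 106, 50, 109, 57, 7, 72, 26, 95, 53, 13, 88, 52, 18, 99, 69, 41, 15, 104,
      82, 62, 44, 28, 14, 2, 105, 97, 91, 87, 85]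
    ?_ ?_ ?_ ?_ ?_ <;> decide +kernel

lemma sqSumsetMin_zmod_139_six [Fact (Nat.Prime 139)] : sqSumsetMin (ZMod 139) 6 = 12 := by
  refine sqSumsetMin_eq_of_noSmallSumset (K := 11) {1, 64, 44, 38, 37, 61}
    [0, 1, 4, 9, 16, 25, 36, 49, 64, 81, 100, 121, 5, 30, 57, 86, 117, 11, 46, 83, 122, 24, 67,
      112, 20, 69, 120, 34, 89, 7, 66, 127, 51, 116, 44, 113, 45, 118, 54, 131, 71, 13, 96, 42,
      129, 79, 31, 124, 80, 38, 137, 99, 63, 29, 136, 106, 78, 52, 28, 6, 125, 107, 91, 77, 65,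
      55, 47, 41, 37, 35]
    ?_ ?_ ?_ ?_ ?_ <;> decide +kernel

lemma sqSumsetMin_zmod_13_six [Fact (Nat.Prime 13)] : sqSumsetMin (ZMod 13) 6 = 13 := by
  refine sqSumsetMin_eq_of_noSmallSumset (K := 12) {1, 0, 4, 2, 3, 6}
    [0, 1, 4, 9, 3, 12, 10]
    ?_ ?_ ?_ ?_ ?_ <;> decide +kernel

lemma sqSumsetMin_zmod_19_six [Fact (Nat.Prime 19)] : sqSumsetMin (ZMod 19) 6 = 13 := by
  refine sqSumsetMin_eq_of_noSmallSumset (K := 12) {1, 2, 9, 8, 7, 6}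
    [0, 1, 4, 9, 16, 6, 17, 11, 7, 5]
    ?_ ?_ ?_ ?_ ?_ <;> decide +kernel

lemma sqSumsetMin_zmod_31_six [Fact (Nat.Prime 31)] : sqSumsetMin (ZMod 31) 6 = 13 := by
  refine sqSumsetMin_eq_of_noSmallSumset (K := 12) {1, 2, 10, 14, 4, 9}
    [0, 1, 4, 9, 16, 25, 5, 18, 2, 19, 7, 28, 20, 14, 10, 8]
    ?_ ?_ ?_ ?_ ?_ <;> decide +kernel

lemma sqSumsetMin_zmod_37_six [Fact (Nat.Prime 37)] : sqSumsetMin (ZMod 37) 6 = 13 := by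
  refine sqSumsetMin_eq_of_noSmallSumset (K := 12) {1, 5, 7, 6, 11, 16}
    [0, 1, 4, 9, 16, 25, 36, 12, 27, 7, 26, 10, 33, 21, 11, 3, 34, 30, 28]
    ?_ ?_ ?_ ?_ ?_ <;> decide +kernel

lemma sqSumsetMin_zmod_59_six [Fact (Nat.Prime 59)] : sqSumsetMin (ZMod 59) 6 = 13 := by
  refine sqSumsetMin_eq_of_noSmallSumset (K := 12) {1, 3, 28, 5, 10, 7}
    [0, 1, 4, 9, 16, 25, 36, 49, 5, 22, 41, 3, 26, 51, 19, 48, 20, 53, 29, 7, 46, 28, 12, 57, 45,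
      35, 27, 21, 17, 15]
    ?_ ?_ ?_ ?_ ?_ <;> decide +kernel

lemma sqSumsetMin_zmod_29_six [Fact (Nat.Prime 29)] : sqSumsetMin (ZMod 29) 6 = 14 := by
  refine sqSumsetMin_eq_of_noSmallSumset (K := 13) {1, 0, 2, 11, 8, 6}
    [0, 1, 4, 9, 16, 25, 7, 20, 6, 23, 13, 5, 28, 24, 22]
    ?_ ?_ ?_ ?_ ?_ <;> decide +kernel

/-- For every prime `p ≥ 11`, the value of `N_6(ℤ_p)`: it is `11` for
`p = 11, 53, 61, 67, 71, 73, 79, 83, 89, 97, 101, 103, 107, 109, 127, 131, 137` and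
`p ≥ 149`; it is `12` for `p = 17, 23, 41, 43, 47, 113, 139`; it is `13` for
`p = 13, 19, 31, 37, 59`; and it is `14` for `p = 29`. -/
theorem sqSumsetMin_zmod_six_cases (p : ℕ) (hp : p.Prime) (hge : 11 ≤ p) :
    ((p = 11 ∨ p = 53 ∨ p = 61 ∨ p = 67 ∨ p = 71 ∨ p = 73 ∨ p = 79 ∨ p = 83 ∨ p = 89 ∨
        p = 97 ∨ p = 101 ∨ p = 103 ∨ p = 107 ∨ p = 109 ∨ p = 127 ∨ p = 131 ∨ p = 137 ∨
        149 ≤ p) → sqSumsetMin (ZMod p) 6 = 11) ∧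
    ((p = 17 ∨ p = 23 ∨ p = 41 ∨ p = 43 ∨ p = 47 ∨ p = 113 ∨ p = 139) →
      sqSumsetMin (ZMod p) 6 = 12) ∧
    ((p = 13 ∨ p = 19 ∨ p = 31 ∨ p = 37 ∨ p = 59) → sqSumsetMin (ZMod p) 6 = 13) ∧
    (p = 29 → sqSumsetMin (ZMod p) 6 = 14) := by
  have := Fact.mk hp
  refine ⟨fun h => ?_, fun h => ?_, fun h => ?_, fun h => ?_⟩
  · refine sqSumsetMin_eq_eleven hge ?_
    rcases h with rfl | rfl | rfl | rfl | rfl | rfl | rfl | rfl | rfl | rfl | rfl | rfl |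
      rfl | rfl | rfl | rfl | rfl | h
    · exact exists_of_roots {1, 0, 5, 2, 4, 3} (by decide +kernel)
    · exact exists_of_roots {1, 2, 22, 13, 15, 4} (by decide +kernel)
    · exact exists_of_roots {1, 5, 7, 16, 6, 11} (by decide +kernel)
    · exact exists_of_roots {1, 33, 10, 7, 20, 9} (by decide +kernel)
    · exact exists_of_roots {0, 1, 12, 28, 2, 17} (by decide +kernel)
    · exact exists_of_roots {1, 26, 16, 36, 0, 23} (by decide +kernel)
    · exact exists_of_roots {1, 24, 19, 15, 22, 36} (by decide +kernel)
    · exact exists_of_roots {1, 3, 10, 5, 38, 37} (by decide +kernel)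
    · exact exists_of_roots {1, 5, 7, 42, 39, 11} (by decide +kernel)
    · exact exists_of_roots {1, 33, 25, 8, 45, 3} (by decide +kernel)
    · exact exists_of_roots {1, 45, 3, 35, 44, 18} (by decide +kernel)
    · exact exists_of_roots {1, 3, 29, 5, 41, 12} (by decide +kernel)
    · exact exists_of_roots {1, 21, 5, 12, 7, 32} (by decide +kernel)
    · exact exists_of_roots {1, 5, 7, 20, 36, 11} (by decide +kernel)
    · exact exists_of_roots {1, 34, 5, 52, 7, 51} (by decide +kernel)
    · exact exists_of_roots {1, 38, 23, 20, 3, 50} (by decide +kernel)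
    · exact exists_of_roots {1, 41, 22, 66, 62, 27} (by decide +kernel)
    · exact exists_card_add_le_eleven h
  · rcases h with rfl | rfl | rfl | rfl | rfl | rfl | rfl
    exacts [sqSumsetMin_zmod_17_six, sqSumsetMin_zmod_23_six, sqSumsetMin_zmod_41_six,
      sqSumsetMin_zmod_43_six, sqSumsetMin_zmod_47_six, sqSumsetMin_zmod_113_six,
      sqSumsetMin_zmod_139_six]
  · rcases h with rfl | rfl | rfl | rfl | rfl
    exacts [sqSumsetMin_zmod_13_six, sqSumsetMin_zmod_19_six, sqSumsetMin_zmod_31_six,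
      sqSumsetMin_zmod_37_six, sqSumsetMin_zmod_59_six]
  · subst h
    exact sqSumsetMin_zmod_29_six
end
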